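/- For N ≥ 1 and an integer s ≥ 2, the sum over compositions Σ_{m_1 + ⋯ + m_s = N, 1 ≤ m_i ≤ N} (m_1 ⋯ m_s)^{1/θ − 1}, where θ > 1 is a fixed real number, equals θ^s · Γ(1 + 1/θ)^s / Γ(s/θ) · N^{s/θ − 1} + O(N^{(s−1)/θ − 1}), with implied constant depending only on θ and s. -/

import Mathlib

open Finset

lemma half_rpow (e x M : ℝ) (hM : 0 < M) (h1 : M / 2 ≤ x) (h2 : x ≤ M) :
    x ^ e ≤ 2 ^ |e| * M ^ e := by
  have hx : 0 < x := by linarith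
  rcases le_or_gt 0 e with he | he
  · calc x ^ e ≤ M ^ e := Real.rpow_le_rpow hx.le h2 he
      _ = 1 * M ^ e := by ring
      _ ≤ _ := by
        gcongr
        exact Real.one_le_rpow (by norm_num) (abs_nonneg _)
  · calc x ^ e ≤ (M / 2) ^ e := Real.rpow_le_rpow_of_nonpos (by linarith) h1 he.le
      _ = 2 ^ |e| * M ^ e := by
        rw [abs_of_neg he, Real.div_rpow hM.le (by norm_num), Real.rpow_neg (by norm_num)]
        field_simp

lemma shift_bound (g : ℕ → ℝ) (e C : ℝ) (hC : 0 ≤ C)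
    (h : ∀ n : ℕ, 1 ≤ n → |g n| ≤ C * (n : ℝ) ^ e) :
    ∃ K, 0 ≤ K ∧ ∀ n : ℕ, |g n| ≤ K * ((n : ℝ) + 1) ^ e := by
  refine ⟨|g 0| + C * 2 ^ |e|, by positivity, fun n => ?_⟩
  rcases Nat.eq_zero_or_pos n with rfl | hn
  · have : 0 ≤ C * (2:ℝ) ^ |e| := by positivity
    simp only [CharP.cast_eq_zero, zero_add, Real.one_rpow, mul_one]
    linarith
  · have hn' : (1 : ℝ) ≤ n := by exact_mod_cast hn
    have h1 := half_rpow e n (n + 1) (by linarith) (by linarith) (by linarith)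
    have h2 : 0 ≤ |g 0| * ((n : ℝ) + 1) ^ e := by positivity
    calc |g n| ≤ C * (n : ℝ) ^ e := h n hn
      _ ≤ C * (2 ^ |e| * ((n : ℝ) + 1) ^ e) := by gcongr
      _ ≤ _ := by nlinarith

lemma sum_pow_bound (p : ℝ) (hp : p ≠ 0) :
    ∃ C, 0 ≤ C ∧ ∀ N : ℕ, ∑ m ∈ range (N + 1), ((m : ℝ) + 1) ^ (p - 1) ≤
      C * ((N : ℝ) + 1) ^ (max p 0) := by
  rcases lt_or_gt_of_ne hp with hp | hp
  · have hs : Summable (fun m : ℕ => ((m : ℝ) + 1) ^ (p - 1)) := by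
      have := (summable_nat_add_iff 1).2 (Real.summable_nat_rpow (p := p - 1) |>.2 (by linarith))
      simpa using this
    refine ⟨∑' m : ℕ, ((m : ℝ) + 1) ^ (p - 1), tsum_nonneg fun _ => by positivity, fun N => ?_⟩
    rw [max_eq_right hp.le, Real.rpow_zero, mul_one]
    exact hs.sum_le_tsum _ fun _ _ => by positivity
  · rw [max_eq_left hp.le]
    rcases le_or_gt 1 p with h1 | h1
    · refine ⟨1, by norm_num, fun N => ?_⟩
      calc _ ≤ ∑ m ∈ range (N + 1), ((N : ℝ) + 1) ^ (p - 1) := by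
            refine sum_le_sum fun m hm => Real.rpow_le_rpow (by positivity) ?_ (by linarith)
            have : m ≤ N := by simpa [Nat.lt_succ_iff] using hm
            have : (m : ℝ) ≤ N := by exact_mod_cast this
            linarith
        _ = _ := by
            rw [sum_const, card_range, nsmul_eq_mul, Real.rpow_sub_one (by positivity)]
            push_cast
            field_simp
    · refine ⟨1 / p, by positivity, fun N => ?_⟩
      induction N with
      | zero => simp; rw [one_le_inv₀ hp]; exact h1.le
      | succ N ih =>
        rw [sum_range_succ]
        refine (add_le_add_left ih _).trans ?_
        push_cast
        set x : ℝ := (N : ℝ) + 1 with hx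
        have hx0 : 0 < x := by positivity
        have hb := rpow_one_add_le_one_add_mul_self (s := -1 / (x + 1)) (p := p)
          (by rw [le_div_iff₀ (by positivity)]; linarith) hp.le h1.le
        have e1 : 1 + -1 / (x + 1) = x / (x + 1) := by field_simp; ring
        rw [e1, Real.div_rpow hx0.le (by positivity), div_le_iff₀ (by positivity)] at hb
        rw [Real.rpow_sub_one (by positivity)]
        have : 1 / p * x ^ p ≤ 1 / p * ((1 + p * (-1 / (x + 1))) * (x + 1) ^ p) := by gcongr
        refine (add_le_add_left this _).trans (le_of_eq ?_)
        field_simp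
        ring

lemma conv_pow (p q r : ℝ) (hp : p ≠ 0) (hq : 0 < q) (hr : q - 1 + max p 0 ≤ r) :
    ∃ K, 0 ≤ K ∧ ∀ N : ℕ, ∑ x ∈ antidiagonal N,
      ((x.1 : ℝ) + 1) ^ (p - 1) * ((x.2 : ℝ) + 1) ^ (q - 1) ≤ K * ((N : ℝ) + 1) ^ r := by
  obtain ⟨A, hA, hA'⟩ := sum_pow_bound p hp
  obtain ⟨B, hB, hB'⟩ := sum_pow_bound q hq.ne'
  refine ⟨2 ^ |q - 1| * A + 2 ^ |p - 1| * B, by positivity, fun N => ?_⟩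
  have hM : (1 : ℝ) ≤ N + 1 := by linarith [Nat.cast_nonneg (α := ℝ) N]
  have hM0 : (0 : ℝ) < N + 1 := by linarith
  calc _ ≤ ∑ x ∈ antidiagonal N, (2 ^ |q - 1| * ((N : ℝ) + 1) ^ (q - 1) * ((x.1 : ℝ) + 1) ^ (p - 1)
        + 2 ^ |p - 1| * ((N : ℝ) + 1) ^ (p - 1) * ((x.2 : ℝ) + 1) ^ (q - 1)) := by
        refine sum_le_sum fun x hx => ?_
        have hx' : (x.1 : ℝ) + x.2 = N := by exact_mod_cast mem_antidiagonal.1 hx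
        have h1 : (0 : ℝ) ≤ x.1 := Nat.cast_nonneg _
        have h2 : (0 : ℝ) ≤ x.2 := Nat.cast_nonneg _
        rcases le_total (x.1 : ℝ) x.2 with h | h
        · have := half_rpow (q - 1) (x.2 + 1) (N + 1) hM0 (by linarith) (by linarith)
          have h3 : 0 ≤ 2 ^ |p - 1| * ((N : ℝ) + 1) ^ (p - 1) * ((x.2 : ℝ) + 1) ^ (q - 1) := by
            positivity
          have h4 : 0 ≤ ((x.1 : ℝ) + 1) ^ (p - 1) := by positivity
          nlinarith
        · have := half_rpow (p - 1) (x.1 + 1) (N + 1) hM0 (by linarith) (by linarith)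
          have h3 : 0 ≤ 2 ^ |q - 1| * ((N : ℝ) + 1) ^ (q - 1) * ((x.1 : ℝ) + 1) ^ (p - 1) := by
            positivity
          have h4 : 0 ≤ ((x.2 : ℝ) + 1) ^ (q - 1) := by positivity
          nlinarith
    _ = 2 ^ |q - 1| * ((N : ℝ) + 1) ^ (q - 1) * (∑ m ∈ range (N + 1), ((m : ℝ) + 1) ^ (p - 1))
        + 2 ^ |p - 1| * ((N : ℝ) + 1) ^ (p - 1) *
          (∑ m ∈ range (N + 1), ((m : ℝ) + 1) ^ (q - 1)) := by
        rw [sum_add_distrib, ← mul_sum, ← mul_sum]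
        congr 2
        · exact Finset.Nat.sum_antidiagonal_eq_sum_range_succ_mk
            (fun x : ℕ × ℕ => ((x.1 : ℝ) + 1) ^ (p - 1)) N
        · rw [← Finset.Nat.sum_antidiagonal_swap]
          exact Finset.Nat.sum_antidiagonal_eq_sum_range_succ_mk
            (fun x : ℕ × ℕ => ((x.1 : ℝ) + 1) ^ (q - 1)) N
    _ ≤ 2 ^ |q - 1| * ((N : ℝ) + 1) ^ (q - 1) * (A * ((N : ℝ) + 1) ^ (max p 0))
        + 2 ^ |p - 1| * ((N : ℝ) + 1) ^ (p - 1) * (B * ((N : ℝ) + 1) ^ (max q 0)) := by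
        gcongr
        · exact hA' N
        · exact hB' N
    _ = 2 ^ |q - 1| * A * ((N : ℝ) + 1) ^ (q - 1 + max p 0)
        + 2 ^ |p - 1| * B * ((N : ℝ) + 1) ^ (p - 1 + max q 0) := by
        rw [Real.rpow_add hM0, Real.rpow_add hM0]; ring
    _ ≤ 2 ^ |q - 1| * A * ((N : ℝ) + 1) ^ r + 2 ^ |p - 1| * B * ((N : ℝ) + 1) ^ r := by
        have := le_max_left p 0
        rw [max_eq_left hq.le]
        gcongr
        · linarith
    _ = _ := by ring

lemma conv_bound (f g : ℕ → ℝ) (A B p q r : ℝ) (hp : p ≠ 0) (hq : 0 < q)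
    (hr : q - 1 + max p 0 ≤ r) (hA : 0 ≤ A) (hB : 0 ≤ B)
    (hf : ∀ n : ℕ, |f n| ≤ A * ((n : ℝ) + 1) ^ (p - 1))
    (hg : ∀ n : ℕ, |g n| ≤ B * ((n : ℝ) + 1) ^ (q - 1)) :
    ∃ K, 0 ≤ K ∧ ∀ N : ℕ, |∑ x ∈ antidiagonal N, f x.1 * g x.2| ≤ K * ((N : ℝ) + 1) ^ r := by
  obtain ⟨K, hK, h⟩ := conv_pow p q r hp hq hr
  refine ⟨A * B * K, by positivity, fun N => ?_⟩
  calc _ ≤ ∑ x ∈ antidiagonal N, |f x.1 * g x.2| := abs_sum_le_sum_abs _ _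
    _ ≤ ∑ x ∈ antidiagonal N, A * B *
        (((x.1 : ℝ) + 1) ^ (p - 1) * ((x.2 : ℝ) + 1) ^ (q - 1)) := by
        refine sum_le_sum fun x _ => ?_
        rw [abs_mul]
        calc _ ≤ (A * ((x.1 : ℝ) + 1) ^ (p - 1)) * (B * ((x.2 : ℝ) + 1) ^ (q - 1)) := by
              gcongr
              · exact hf _
              · exact hg _
          _ = _ := by ring
    _ ≤ A * B * (K * ((N : ℝ) + 1) ^ r) := by
        rw [← mul_sum]; gcongr; exact h N
    _ = _ := by ring

lemma gamma_ratio_small (x : ℝ) (hx : 0 < x) (hx1 : x ≤ 1) (n : ℕ) (hn : 1 ≤ n) :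
    |Real.Gamma (n + x) / (n.factorial : ℝ) - (n : ℝ) ^ (x - 1)| ≤ 1 * (n : ℝ) ^ (x - 2) := by
  have hn' : (1 : ℝ) ≤ n := by exact_mod_cast hn
  have hn0 : (0 : ℝ) < n := by linarith
  have hfeq : ∀ {y : ℝ}, 0 < y →
      (Real.log ∘ Real.Gamma) (y + 1) = (Real.log ∘ Real.Gamma) y + Real.log y := by
    intro y hy
    simp only [Function.comp]
    rw [Real.Gamma_add_one hy.ne', Real.log_mul hy.ne' (Real.Gamma_pos_of_pos hy).ne', add_comm]
  have hG : 0 < Real.Gamma (n + x) := Real.Gamma_pos_of_pos (by linarith)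
  have hGn : 0 < Real.Gamma n := Real.Gamma_pos_of_pos hn0
  have hfac : (n.factorial : ℝ) = n * Real.Gamma n := by
    rw [← Real.Gamma_nat_eq_factorial, Real.Gamma_add_one hn0.ne']
  have up := Real.BohrMollerup.f_add_nat_le Real.convexOn_log_Gamma hfeq
    (by omega : n ≠ 0) hx hx1
  have lo := Real.BohrMollerup.f_add_nat_ge Real.convexOn_log_Gamma hfeq
    (by omega : 2 ≤ n + 1) hx
  have up' : Real.Gamma (n + x) ≤ Real.Gamma n * (n : ℝ) ^ x := by
    rw [← Real.log_le_log_iff hG (by positivity), Real.log_mul hGn.ne' (by positivity),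
      Real.log_rpow hn0]
    exact up
  have lo' : (n : ℝ) * Real.Gamma n * (n : ℝ) ^ x ≤ (n + x) * Real.Gamma (n + x) := by
    rw [← Real.log_le_log_iff (by positivity) (by positivity), Real.log_mul (by positivity)
      (by positivity), Real.log_rpow hn0, ← Real.Gamma_add_one hn0.ne',
      ← Real.Gamma_add_one (by positivity)]
    push_cast at lo
    simp only [Function.comp, add_sub_cancel_right] at lo
    rw [show (n : ℝ) + x + 1 = n + 1 + x by ring]
    exact lo
  have e1 : (n : ℝ) ^ (x - 2) = (n : ℝ) ^ x / n ^ 2 := by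
    rw [show x - 2 = x - (2 : ℕ) by norm_num, Real.rpow_sub_natCast hn0.ne']
  rw [Real.rpow_sub_one hn0.ne', e1, hfac, abs_le]
  have hP : 0 < (n : ℝ) ^ x := by positivity
  set P := (n : ℝ) ^ x
  set G := Real.Gamma n
  set H := Real.Gamma (n + x)
  constructor
  · rw [← sub_nonneg]
    have : H / (n * G) - P / n - -(1 * (P / n ^ 2)) = (n * H - n * G * P + G * P) / (n ^ 2 * G) := by
      field_simp
      ring
    rw [this]
    apply div_nonneg _ (by positivity)
    have : x * H ≤ 1 * (G * P) := by gcongr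
    linarith
  · have : H / (n * G) ≤ P / n := by
      rw [div_le_div_iff₀ (by positivity) hn0]
      nlinarith
    have : 0 ≤ 1 * (P / (n : ℝ) ^ 2) := by positivity
    linarith

lemma gamma_ratio (k : ℕ) : ∀ x : ℝ, 0 < x → x ≤ k + 1 → ∃ C, 0 ≤ C ∧ ∀ n : ℕ, 1 ≤ n →
    |Real.Gamma (n + x) / (n.factorial : ℝ) - (n : ℝ) ^ (x - 1)| ≤ C * (n : ℝ) ^ (x - 2) := by
  induction k with
  | zero =>
    intro x hx hx1
    exact ⟨1, by norm_num, fun n hn => gamma_ratio_small x hx (by simpa using hx1) n hn⟩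
  | succ k ih =>
    intro x hx hxk
    rcases le_or_gt x 1 with h1 | h1
    · exact ⟨1, by norm_num, fun n hn => gamma_ratio_small x hx h1 n hn⟩
    obtain ⟨C, hC, h⟩ := ih (x - 1) (by linarith) (by push_cast at hxk; linarith)
    refine ⟨x + x * C, by positivity, fun n hn => ?_⟩
    have hn' : (1 : ℝ) ≤ n := by exact_mod_cast hn
    have hn0 : (0 : ℝ) < n := by linarith
    have h2 := h n hn
    set y := x - 1 with hy
    have hy0 : 0 < y := by linarith
    have e0 : x = y + 1 := by linarith
    have e1 : Real.Gamma (n + x) = (n + y) * Real.Gamma (n + y) := by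
      rw [← Real.Gamma_add_one (by positivity)]; congr 1; linarith
    have e2 : (n : ℝ) ^ y = n * (n : ℝ) ^ (y - 1) := by
      rw [Real.rpow_sub_one hn0.ne' y]; field_simp
    have e3 : (n : ℝ) ^ (x - 2) = (n : ℝ) ^ (y - 1) := by congr 1; linarith
    have e4 : (n : ℝ) ^ (y - 1) = n * (n : ℝ) ^ (y - 2) := by
      rw [show y - 2 = y - 1 - 1 by ring, Real.rpow_sub_one hn0.ne' (y - 1)]; field_simp
    rw [e1, e2, e3]
    set P := (n : ℝ) ^ (y - 1)
    set Q := (n : ℝ) ^ (y - 2)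
    have hQ : 0 < Q := by positivity
    have : (n + y) * Real.Gamma (n + y) / (n.factorial : ℝ) - n * P
      = (n + y) * (Real.Gamma (n + y) / (n.factorial : ℝ) - P) + y * P := by ring
    rw [this]
    refine (abs_add_le _ _).trans ?_
    rw [abs_mul, abs_of_nonneg (by positivity : 0 ≤ n + y),
      abs_of_nonneg (by positivity : 0 ≤ y * P)]
    have : (n + y) * |Real.Gamma (n + y) / (n.factorial : ℝ) - P| ≤ (n * x) * (C * Q) := by
      gcongr
      nlinarith
    have e5 : (n * x) * (C * Q) = x * C * P := by rw [e4]; ring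
    have : 0 < P := by positivity
    nlinarith

noncomputable def cc (x : ℝ) (n : ℕ) : ℝ := Real.Gamma (n + x) / (n.factorial : ℝ) / Real.Gamma x

lemma cc_zero (x : ℝ) (hx : 0 < x) : cc x 0 = 1 := by
  have := (Real.Gamma_pos_of_pos hx).ne'
  simp [cc, this]

lemma cc_succ (x : ℝ) (hx : 0 < x) (n : ℕ) : ((n : ℝ) + 1) * cc x (n + 1) = (n + x) * cc x n := by
  have := (Real.Gamma_pos_of_pos hx).ne'
  have e : Real.Gamma ((n + 1 : ℕ) + x) = (n + x) * Real.Gamma (n + x) := by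
    rw [← Real.Gamma_add_one (by positivity)]; congr 1; push_cast; ring
  rw [cc, cc, e, Nat.factorial_succ]
  have : (n.factorial : ℝ) ≠ 0 := by positivity
  push_cast
  field_simp

lemma cc_conv (x y : ℝ) (hx : 0 < x) (hy : 0 < y) (N : ℕ) :
    ∑ p ∈ antidiagonal N, cc x p.1 * cc y p.2 = cc (x + y) N := by
  induction N with
  | zero => simp [cc_zero, hx, hy, add_pos hx hy]
  | succ N ih =>
    have h0 : ((N : ℝ) + 1) ≠ 0 := by positivity
    apply mul_left_cancel₀ h0
    rw [cc_succ _ (by positivity), ← ih]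
    have : ((N : ℝ) + 1) * ∑ p ∈ antidiagonal (N + 1), cc x p.1 * cc y p.2 =
        ∑ p ∈ antidiagonal (N + 1), (p.1 : ℝ) * cc x p.1 * cc y p.2 +
        ∑ p ∈ antidiagonal (N + 1), cc x p.1 * ((p.2 : ℝ) * cc y p.2) := by
      rw [← sum_add_distrib, mul_sum]
      refine sum_congr rfl fun p hp => ?_
      have : (p.1 : ℝ) + p.2 = N + 1 := by exact_mod_cast mem_antidiagonal.1 hp
      rw [← this]; ring
    rw [this, Finset.Nat.sum_antidiagonal_succ, Finset.Nat.sum_antidiagonal_succ']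
    push_cast
    simp only [cc_succ _ hx, cc_succ _ hy]
    rw [zero_mul, zero_mul, zero_mul, mul_zero, zero_add, zero_add, ← sum_add_distrib, mul_sum]
    refine sum_congr rfl fun p hp => ?_
    have : (p.1 : ℝ) + p.2 = N := by exact_mod_cast mem_antidiagonal.1 hp
    rw [← this]; ring

lemma cc_asymp (x : ℝ) (hx : 0 < x) : ∃ C, 0 ≤ C ∧ ∀ n : ℕ, 1 ≤ n →
    |cc x n - (n : ℝ) ^ (x - 1) / Real.Gamma x| ≤ C * (n : ℝ) ^ (x - 2) := by
  obtain ⟨k, hk⟩ := exists_nat_ge x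
  obtain ⟨C, hC, h⟩ := gamma_ratio k x hx (by linarith)
  have hG := Real.Gamma_pos_of_pos hx
  refine ⟨C / Real.Gamma x, by positivity, fun n hn => ?_⟩
  rw [cc, ← sub_div, abs_div, abs_of_pos hG, div_mul_eq_mul_div]
  gcongr
  exact h n hn

lemma cc_bound (x : ℝ) (hx : 0 < x) : ∃ C, 0 ≤ C ∧ ∀ n : ℕ,
    |cc x n| ≤ C * ((n : ℝ) + 1) ^ (x - 1) := by
  obtain ⟨C, hC, h⟩ := cc_asymp x hx
  have hG := Real.Gamma_pos_of_pos hx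
  refine shift_bound (cc x) (x - 1) (C + 1 / Real.Gamma x) (by positivity) fun n hn => ?_
  have hn' : (1 : ℝ) ≤ n := by exact_mod_cast hn
  have h1 := h n hn
  have h2 : (n : ℝ) ^ (x - 2) ≤ (n : ℝ) ^ (x - 1) :=
    Real.rpow_le_rpow_of_exponent_le hn' (by linarith)
  have h3 : C * (n : ℝ) ^ (x - 2) ≤ C * (n : ℝ) ^ (x - 1) := by gcongr
  have h4 : |(n : ℝ) ^ (x - 1) / Real.Gamma x| = 1 / Real.Gamma x * (n : ℝ) ^ (x - 1) := by
    rw [abs_of_nonneg (by positivity)]; ring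
  have h5 := abs_sub_abs_le_abs_sub (cc x n) ((n : ℝ) ^ (x - 1) / Real.Gamma x)
  rw [h4] at h5
  linarith

noncomputable def WW (a : ℝ) : PowerSeries ℝ := PowerSeries.mk fun n => (n : ℝ) ^ (a - 1)

lemma err_bound (a : ℝ) (ha : 0 < a) (ha1 : a < 1) (s : ℕ) :
    ∃ C, 0 ≤ C ∧ ∀ N : ℕ, |PowerSeries.coeff N (WW a ^ (s + 1)) -
      Real.Gamma a ^ (s + 1) * cc ((s + 1 : ℕ) * a) N| ≤
        C * ((N : ℝ) + 1) ^ ((if s = 0 then a - 1 else s * a) - 1) := by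
  have hG := Real.Gamma_pos_of_pos ha
  -- basic error
  have he : ∃ C, 0 ≤ C ∧ ∀ n : ℕ, |(n : ℝ) ^ (a - 1) - Real.Gamma a * cc a n| ≤
      C * ((n : ℝ) + 1) ^ ((a - 1) - 1) := by
    obtain ⟨C, hC, h⟩ := cc_asymp a ha
    refine shift_bound _ _ (Real.Gamma a * C) (by positivity) fun n hn => ?_
    have := h n hn
    have e : (n : ℝ) ^ (a - 1) - Real.Gamma a * cc a n =
      - (Real.Gamma a * (cc a n - (n : ℝ) ^ (a - 1) / Real.Gamma a)) := by
      field_simp; ring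
    rw [e, abs_neg, abs_mul, abs_of_pos hG, mul_assoc, show a - 1 - 1 = a - 2 by ring]
    gcongr
  have hw : ∃ C, 0 ≤ C ∧ ∀ n : ℕ, |(n : ℝ) ^ (a - 1)| ≤ C * ((n : ℝ) + 1) ^ (a - 1) := by
    refine shift_bound (fun n : ℕ => (n : ℝ) ^ (a - 1)) _ 1 (by norm_num) fun n hn => ?_
    rw [abs_of_nonneg (by positivity), one_mul]
  induction s with
  | zero =>
    obtain ⟨C, hC, h⟩ := he
    refine ⟨C, hC, fun N => ?_⟩
    simpa [WW] using h N
  | succ s ih =>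
    obtain ⟨C1, hC1, h1⟩ := ih
    obtain ⟨C2, hC2, h2⟩ := he
    obtain ⟨C3, hC3, h3⟩ := hw
    have hsa : 0 < ((s + 1 : ℕ) : ℝ) * a := by positivity
    obtain ⟨C4, hC4, h4⟩ := cc_bound _ hsa
    set r : ℝ := ((s + 1 : ℕ) : ℝ) * a - 1 with hr
    obtain ⟨K1, hK1, H1⟩ := conv_bound _ (fun n : ℕ => (n : ℝ) ^ (a - 1)) C1 C3 _ a r
      (by split_ifs with h0
          · linarith
          · have : (0 : ℝ) < s := by exact_mod_cast Nat.pos_of_ne_zero h0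
            positivity) ha
      (by split_ifs with h0
          · rw [max_eq_right (by linarith), hr, h0]; push_cast; linarith
          · rw [max_eq_left (by positivity), hr]; push_cast; linarith) hC1 hC3 h1 h3
    obtain ⟨K2, hK2, H2⟩ := conv_bound _ _ C2 C4 (a - 1) _ r (by linarith) hsa
      (by rw [max_eq_right (by linarith), hr]; linarith) hC2 hC4 h2 h4
    refine ⟨K1 + Real.Gamma a ^ (s + 1) * K2, by positivity, fun N => ?_⟩
    rw [if_neg (Nat.succ_ne_zero s)]
    have key : PowerSeries.coeff N (WW a ^ (s + 1 + 1)) -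
      Real.Gamma a ^ (s + 1 + 1) * cc ((s + 1 + 1 : ℕ) * a) N =
      ∑ x ∈ antidiagonal N, (PowerSeries.coeff x.1 (WW a ^ (s + 1)) -
        Real.Gamma a ^ (s + 1) * cc ((s + 1 : ℕ) * a) x.1) * (x.2 : ℝ) ^ (a - 1) +
      Real.Gamma a ^ (s + 1) * ∑ x ∈ antidiagonal N,
        ((x.1 : ℝ) ^ (a - 1) - Real.Gamma a * cc a x.1) * cc ((s + 1 : ℕ) * a) x.2 := by
      have e : ((s + 1 + 1 : ℕ) : ℝ) * a = (s + 1 : ℕ) * a + a := by push_cast; ring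
      rw [e, ← cc_conv _ _ hsa ha, pow_succ (WW a), PowerSeries.coeff_mul,
        ← Finset.Nat.sum_antidiagonal_swap (n := N) (f := fun x : ℕ × ℕ =>
        ((x.1 : ℝ) ^ (a - 1) - Real.Gamma a * cc a x.1) * cc ((s + 1 : ℕ) * a) x.2),
        mul_sum, mul_sum, ← sum_sub_distrib, ← sum_add_distrib]
      refine sum_congr rfl fun x _ => ?_
      have : PowerSeries.coeff x.2 (WW a) = (x.2 : ℝ) ^ (a - 1) := by simp [WW]
      rw [this]
      simp only [Prod.fst_swap, Prod.snd_swap]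
      ring
    rw [key]
    refine (abs_add_le _ _).trans ?_
    rw [abs_mul, abs_of_pos (by positivity : 0 < Real.Gamma a ^ (s + 1)), add_mul, mul_assoc]
    gcongr
    · exact H1 N
    · exact H2 N

lemma coeff_eq (a : ℝ) (ha1 : a < 1) (s : ℕ) (N : ℕ) :
    (∑ m ∈ (Fintype.piFinset fun _ : Fin s => Finset.Icc 1 N).filter
            (fun m => ∑ i, m i = N),
          ∏ i, (m i : ℝ) ^ (a - 1)) = PowerSeries.coeff N (WW a ^ s) := by
  have : WW a ^ s = ∏ _i : Fin s, WW a := by simp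
  rw [this, PowerSeries.coeff_prod]
  refine sum_of_injOn (fun m => Finsupp.equivFunOnFinite.symm m)
    (Finsupp.equivFunOnFinite.symm.injective.injOn) ?_ ?_ ?_
  · intro m hm
    simp only [coe_filter, Set.mem_setOf_eq] at hm
    simp only [mem_coe, mem_finsuppAntidiag]
    exact ⟨by simpa using hm.2, subset_univ _⟩
  · intro l hl hl'
    by_contra hne
    rw [← ne_eq, prod_ne_zero_iff] at hne
    apply hl'
    rw [mem_finsuppAntidiag] at hl
    refine ⟨l, ?_, by ext; simp⟩
    simp only [coe_filter, Set.mem_setOf_eq, Fintype.mem_piFinset, mem_Icc]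
    refine ⟨fun i => ⟨?_, ?_⟩, hl.1⟩
    · rw [Nat.one_le_iff_ne_zero]
      intro h0
      apply hne i (mem_univ i)
      simp only [WW, PowerSeries.coeff_mk, h0, Nat.cast_zero]
      exact Real.zero_rpow (by linarith)
    · rw [← hl.1]
      exact single_le_sum (fun _ _ => Nat.zero_le _) (mem_univ i)
  · intro m _
    simp [WW]

/-- The composition sum
`Σ_{m_1 + ⋯ + m_s = N, m_i ≥ 1} (m_1 ⋯ m_s)^{1/θ − 1}
  = θ^s Γ(1 + 1/θ)^s / Γ(s/θ) · N^{s/θ − 1} + O(N^{(s−1)/θ − 1})`. -/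
theorem composition_sum_asymptotic (θ : ℝ) (hθ : 1 < θ) (s : ℕ) (hs : 2 ≤ s) :
    ∃ C > (0 : ℝ), ∀ N : ℕ, 1 ≤ N →
      |(∑ m ∈ (Fintype.piFinset fun _ : Fin s => Finset.Icc 1 N).filter
            (fun m => ∑ i, m i = N),
          ∏ i, (m i : ℝ) ^ (1 / θ - 1)) -
          θ ^ s * Real.Gamma (1 + 1 / θ) ^ s / Real.Gamma ((s : ℝ) / θ) *
            (N : ℝ) ^ ((s : ℝ) / θ - 1)| ≤
        C * (N : ℝ) ^ (((s : ℝ) - 1) / θ - 1) := by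
  have hθ0 : 0 < θ := by linarith
  have ha : 0 < 1 / θ := by positivity
  have ha1 : 1 / θ < 1 := by rw [div_lt_one hθ0]; exact hθ
  obtain ⟨t, rfl⟩ : ∃ t, s = t + 1 := ⟨s - 1, by omega⟩
  have ht : t ≠ 0 := by omega
  have e1 : θ ^ (t + 1) * Real.Gamma (1 + 1 / θ) ^ (t + 1) = Real.Gamma (1 / θ) ^ (t + 1) := by
    rw [← mul_pow, add_comm, Real.Gamma_add_one ha.ne']
    congr 1
    field_simp
  have e2 : ((t + 1 : ℕ) : ℝ) / θ = (t + 1 : ℕ) * (1 / θ) := by ring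
  have e3 : (((t + 1 : ℕ) : ℝ) - 1) / θ - 1 = t * (1 / θ) - 1 := by push_cast; ring
  rw [e1, e2, e3]
  simp only [coeff_eq (1 / θ) ha1]
  set a := 1 / θ with hadef
  obtain ⟨C1, hC1, h1⟩ := err_bound a ha ha1 t
  rw [if_neg ht] at h1
  set x : ℝ := (t + 1 : ℕ) * a with hx
  have hx0 : 0 < x := by positivity
  obtain ⟨C2, hC2, h2⟩ := cc_asymp x hx0
  have hG := Real.Gamma_pos_of_pos ha
  set e : ℝ := t * a - 1 with he
  refine ⟨C1 * (2 ^ |e| * 2 ^ e) + Real.Gamma a ^ (t + 1) * C2 + 1, by positivity, fun N hN => ?_⟩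
  have hN' : (1 : ℝ) ≤ N := by exact_mod_cast hN
  have h3 := half_rpow e (N + 1) (2 * N) (by linarith) (by linarith) (by linarith)
  rw [Real.mul_rpow (by norm_num) (by linarith)] at h3
  have h4 : (N : ℝ) ^ (x - 2) ≤ (N : ℝ) ^ e := by
    refine Real.rpow_le_rpow_of_exponent_le hN' ?_
    rw [hx, he]; push_cast; linarith
  have key : PowerSeries.coeff N (WW a ^ (t + 1)) -
      Real.Gamma a ^ (t + 1) / Real.Gamma x * (N : ℝ) ^ (x - 1) =
      (PowerSeries.coeff N (WW a ^ (t + 1)) - Real.Gamma a ^ (t + 1) * cc x N) +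
      Real.Gamma a ^ (t + 1) * (cc x N - (N : ℝ) ^ (x - 1) / Real.Gamma x) := by ring
  rw [key]
  refine (abs_add_le _ _).trans ?_
  rw [abs_mul, abs_of_pos (by positivity : 0 < Real.Gamma a ^ (t + 1))]
  have h5 : C1 * ((N : ℝ) + 1) ^ e ≤ C1 * (2 ^ |e| * (2 ^ e * (N : ℝ) ^ e)) := by gcongr
  have h6 : Real.Gamma a ^ (t + 1) * |cc x N - (N : ℝ) ^ (x - 1) / Real.Gamma x| ≤
      Real.Gamma a ^ (t + 1) * (C2 * (N : ℝ) ^ e) := by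
    gcongr
    exact (h2 N hN).trans (by gcongr)
  have h7 : 0 ≤ (N : ℝ) ^ e := by positivity
  have h8 := h1 N
  linarith
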